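/- arXiv:2511.15595 — 2 statements merged into one kernel-verified Lean document; each statement's English description precedes it below -/
import Mathlib

section
/- The sequence (n_k)_{k≥1} constructed from blocks Δ_i and sub-blocks Δ_i^{(m)} satisfies the Diophantine bound L(N,a,b) = O(N/g_N) for all positive integers a,b, along the subsequence of values N = N_i := max Δ_i, i ∈ ℕ; that is, for all a,b ∈ ℕ there is a constant C (depending on a,b) with L(N_i, a, b) ≤ C·N_i/g_{N_i} for all i. -/
open Filter

/-- The block `Δ_i = {2^{3^i−1}, …, 2^{3^{i+1}−1} − 1}`. -/
def Blk (i : ℕ) : Finset ℕ := Finset.Ico (2^(3^i - 1)) (2^(3^(i+1) - 1))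

/-- `M(i) = ⌈g(#Δ_i)⌉`. -/
noncomputable def Mblk (g : ℕ → ℝ) (i : ℕ) : ℕ := ⌈g ((Blk i).card)⌉₊

/-- `N_i = max Δ_i = 2^{3^{i+1}−1} − 1`. -/
def Nmax (i : ℕ) : ℕ := 2^(3^(i+1) - 1) - 1

/-- Number of solutions `(k,ℓ)`, `1 ≤ k,ℓ ≤ N`, of `a n_k - b n_ℓ = c`. -/
def solCount (n : ℕ → ℕ) (N a b : ℕ) (c : ℤ) : ℕ :=
  ((Finset.Icc 1 N ×ˢ Finset.Icc 1 N).filter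
    (fun p => (a : ℤ) * n p.1 - (b : ℤ) * n p.2 = c)).card


theorem sep_aux (d U V u v : ℕ) (hU : d ∣ U) (hV : d ∣ V) (hu : u < d) (hv : v < d)
    (h : U + u = V + v) : U = V ∧ u = v := by
  obtain ⟨x, rfl⟩ := hU
  obtain ⟨y, rfl⟩ := hV
  have h1 : (d * x + u) % d = u := by rw [Nat.mul_add_mod]; exact Nat.mod_eq_of_lt hu
  have h2 : (d * y + v) % d = v := by rw [Nat.mul_add_mod]; exact Nat.mod_eq_of_lt hv
  have h3 : u = v := by rw [← h1, ← h2, h]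
  subst h3
  exact ⟨by omega, rfl⟩

theorem odd_aux (u v x y : ℕ) (hx : Odd x) (hy : Odd y) (h : 2^u * x = 2^v * y) : u = v := by
  wlog huv : u ≤ v generalizing u v x y
  · exact (this v u y x hy hx h.symm (by omega)).symm
  obtain ⟨e, rfl⟩ := Nat.exists_eq_add_of_le huv
  rw [pow_add, mul_assoc] at h
  have h2 := Nat.eq_of_mul_eq_mul_left (by positivity) h
  rcases Nat.eq_zero_or_pos e with h0 | h0
  · omega
  · exfalso
    obtain ⟨f, rfl⟩ := Nat.exists_eq_succ_of_ne_zero h0.ne'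
    rw [pow_succ] at h2
    obtain ⟨z, hz⟩ := hx
    have : x = 2 * (2^f * y) := by rw [h2]; ring
    omega

theorem x1_aux (α β a b K L K' L' : ℕ) (ha : Odd a) (hb : Odd b) (hK : K < K')
    (h : 2^α * a * 2^K + 2^β * b * 2^L' = 2^α * a * 2^K' + 2^β * b * 2^L) :
    α + K = β + L := by
  have ha0 : 0 < a := ha.pos
  have hb0 : 0 < b := hb.pos
  have hlt : 2^α * a * 2^K < 2^α * a * 2^K' := by
    have := Nat.pow_lt_pow_right (a := 2) (by norm_num) hK
    exact Nat.mul_lt_mul_of_pos_left this (by positivity)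
  have hL : L < L' := by
    by_contra hc
    have : 2^β * b * 2^L' ≤ 2^β * b * 2^L :=
      Nat.mul_le_mul_left _ (Nat.pow_le_pow_right (by norm_num) (by omega))
    omega
  obtain ⟨p, rfl⟩ := Nat.exists_eq_add_of_lt hK
  obtain ⟨r, rfl⟩ := Nat.exists_eq_add_of_lt hL
  obtain ⟨P, hP⟩ : ∃ P, 2^(p+1) = P + 1 := ⟨2^(p+1) - 1, (Nat.sub_add_cancel Nat.one_le_two_pow).symm⟩
  obtain ⟨Q, hQ⟩ : ∃ Q, 2^(r+1) = Q + 1 := ⟨2^(r+1) - 1, (Nat.sub_add_cancel Nat.one_le_two_pow).symm⟩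
  have oP : Odd P := by
    rw [Nat.odd_iff]; rw [pow_succ] at hP; omega
  have oQ : Odd Q := by
    rw [Nat.odd_iff]; rw [pow_succ] at hQ; omega
  rw [add_assoc K, add_assoc L, pow_add 2 K, pow_add 2 L, hP, hQ] at h
  apply odd_aux (α + K) (β + L) (a * P) (b * Q) (ha.mul oP) (hb.mul oQ)
  rw [pow_add, pow_add]
  nlinarith

theorem x2_aux (a b e f : ℕ) (hef : e < f)
    (h : 2^e * a + 2^f * b = 2^f * a + 2^e * b) : a = b := by
  have := Nat.pow_lt_pow_right (a := 2) (by norm_num) hef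
  obtain ⟨d, hd⟩ := Nat.exists_eq_add_of_lt this
  rw [hd] at h
  have h2 : (d + 1) * b = (d + 1) * a := by nlinarith
  exact (Nat.eq_of_mul_eq_mul_left (by omega) h2).symm

/-- Abstract properties of the sequence on the large blocks. -/
structure Good (a b : ℕ) (n T q : ℕ → ℕ) (R : ℕ → ℕ → ℕ → Prop) : Prop where
  ha : 1 ≤ a
  hb : 1 ≤ b
  form : ∀ k j m, R k j m → n k = 2^(T j) * (2^(k + j*m) + m)
  mpos : ∀ k j m, R k j m → 1 ≤ m
  qle : ∀ k j m, R k j m → q j ≤ k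
  small : ∀ k j m k' m', R k j m → R k' j m' → a * m + b * m' < 2^(q j)
  sza : ∀ k j m, R k j m → 2 * (a * n k) < 2^(T (j+1))
  szb : ∀ k j m, R k j m → 2 * (b * n k) < 2^(T (j+1))
  mono : Monotone T
  ord : ∀ k j m k' m', R k j m → R k' j m' → m < m' → k < k'
  la : ∀ k j m, R k j m → a ≤ 2^j
  lb : ∀ k j m, R k j m → b ≤ 2^j

namespace Good

variable {a b : ℕ} {n T q : ℕ → ℕ} {R : ℕ → ℕ → ℕ → Prop}

theorem symm (h : Good a b n T q R) : Good b a n T q R where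
  ha := h.hb
  hb := h.ha
  form := h.form
  mpos := h.mpos
  qle := h.qle
  small := fun k j m k' m' h1 h2 => by have := h.small k' j m' k m h2 h1; omega
  sza := h.szb
  szb := h.sza
  mono := h.mono
  ord := h.ord
  la := h.lb
  lb := h.la

theorem powT (h : Good a b n T q R) {j j' : ℕ} (hj : j < j') : 2^(T (j+1)) ≤ 2^(T j') :=
  Nat.pow_le_pow_right (by norm_num) (h.mono hj)

theorem dvdn (h : Good a b n T q R) {k j m : ℕ} (hk : R k j m) : 2^(T j) ∣ n k :=
  ⟨_, h.form _ _ _ hk⟩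

theorem npos (h : Good a b n T q R) {k j m : ℕ} (hk : R k j m) : 2^(T j) ≤ n k := by
  rw [h.form _ _ _ hk]
  exact Nat.le_mul_of_pos_right _ (by positivity)

theorem nup (h : Good a b n T q R) {k j m : ℕ} (hk : R k j m) : n k < 2^(T (j+1)) := by
  have h1 := h.sza _ _ _ hk
  have := Nat.le_mul_of_pos_left (n k) h.ha
  omega

theorem mlt (h : Good a b n T q R) {k j m : ℕ} (hk : R k j m) : m < 2^(q j) := by
  have h1 := h.small _ _ _ _ _ hk hk
  have := Nat.le_mul_of_pos_left m h.ha
  omega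

theorem dvdq (h : Good a b n T q R) {k j m : ℕ} (hk : R k j m) : 2^(q j) ∣ 2^(k+j*m) :=
  Nat.pow_dvd_pow _ ((h.qle _ _ _ hk).trans (by omega))

theorem eqK (h : Good a b n T q R) {k j m k' m' : ℕ} (hk : R k j m) (hk' : R k' j m')
    (e : k + j * m = k' + j * m') : m = m' := by
  rcases lt_trichotomy m m' with hl | hl | hl
  · have := h.ord _ _ _ _ _ hk hk' hl
    have := Nat.mul_le_mul_left j hl.le
    omega
  · exact hl
  · have := h.ord _ _ _ _ _ hk' hk hl
    have := Nat.mul_le_mul_left j hl.le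
    omega

theorem inj (h : Good a b n T q R) {k j m k' j' m' : ℕ} (hk : R k j m) (hk' : R k' j' m')
    (e : n k = n k') : k = k' := by
  have h1 := h.nup hk
  have h2 := h.nup hk'
  have h3 := h.npos hk
  have h4 := h.npos hk'
  rcases lt_trichotomy j j' with hl | hl | hl
  · have := h.powT hl
    omega
  · subst hl
    rw [h.form _ _ _ hk, h.form _ _ _ hk'] at e
    have e2 := Nat.eq_of_mul_eq_mul_left (by positivity) e
    obtain ⟨e3, e4⟩ := sep_aux _ _ _ _ _ (h.dvdq hk) (h.dvdq hk') (h.mlt hk) (h.mlt hk') e2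
    have e5 := Nat.pow_right_injective (le_refl 2) e3
    subst e4
    omega
  · have := h.powT hl
    omega

/-- Off-diagonal blocks: at most one solution. -/
theorem off (h : Good a b n T q R) {k j m l i s k' j' m' l' i' s' : ℕ}
    (hk : R k j m) (hl : R l i s) (hij : i < j)
    (hk' : R k' j' m') (hl' : R l' i' s') (hij' : i' < j')
    (e : a * n k + b * n l' = a * n k' + b * n l) : k = k' ∧ l = l' := by
  have p1 := h.sza _ _ _ hk
  have p2 := h.sza _ _ _ hk'
  have p3 := h.szb _ _ _ hl
  have p4 := h.szb _ _ _ hl'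
  have p5 := h.npos hk
  have p6 := h.npos hk'
  have p7 := Nat.le_mul_of_pos_left (n k) h.ha
  have p8 := Nat.le_mul_of_pos_left (n k') h.ha
  have p9 := h.powT hij
  have p10 := h.powT hij'
  rcases lt_trichotomy j j' with hh | hh | hh
  · have := h.powT hh
    omega
  · subst hh
    obtain ⟨e1, e2⟩ := sep_aux (2^(T j)) _ _ _ _ ((h.dvdn hk).mul_left a) ((h.dvdn hk').mul_left a)
      (by omega) (by omega) e
    exact ⟨h.inj hk hk' (Nat.eq_of_mul_eq_mul_left h.ha e1),
      (h.inj hl' hl (Nat.eq_of_mul_eq_mul_left h.hb e2)).symm⟩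
  · have := h.powT hh
    omega

theorem diag_m_le (h : Good a b n T q R) {k j m l s : ℕ} (hk : R k j m) (hl : R l j s)
    (e : a * 2^(k+j*m) = b * 2^(l+j*s)) : s ≤ m := by
  by_contra hc
  push Not at hc
  have h1 := h.ord _ _ _ _ _ hk hl hc
  have h2 : j * (m + 1) ≤ j * s := Nat.mul_le_mul_left j hc
  rw [mul_add] at h2
  have h3 : 2^(k+j*m + (j+1)) ≤ 2^(l+j*s) := Nat.pow_le_pow_right (by norm_num) (by omega)
  have h4 := Nat.le_mul_of_pos_left (2^(l+j*s)) h.hb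
  have h5 := h.la _ _ _ hk
  have h6 : a * 2^(k+j*m) ≤ 2^j * 2^(k+j*m) := Nat.mul_le_mul_right _ h5
  rw [pow_add 2 (k+j*m), pow_succ] at h3
  have h7 : 0 < 2^j * 2^(k+j*m) := by positivity
  nlinarith

theorem diag_m (h : Good a b n T q R) {k j m l s : ℕ} (hk : R k j m) (hl : R l j s)
    (e : a * 2^(k+j*m) = b * 2^(l+j*s)) : m = s :=
  le_antisymm (h.symm.diag_m_le hl hk e.symm) (h.diag_m_le hk hl e)

theorem diag_zero (h : Good a b n T q R) {k j m l s : ℕ} (hk : R k j m) (hl : R l j s)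
    (e : a * n k = b * n l) : a = b := by
  rw [h.form _ _ _ hk, h.form _ _ _ hl, mul_left_comm, mul_left_comm b] at e
  have e2 := Nat.eq_of_mul_eq_mul_left (by positivity) e
  rw [mul_add, mul_add] at e2
  have hs := h.small _ _ _ _ _ hk hl
  obtain ⟨e3, e4⟩ := sep_aux (2^(q j)) _ _ _ _ ((h.dvdq hk).mul_left a) ((h.dvdq hl).mul_left b)
      (by omega) (by omega) e2
  have e5 := h.diag_m hk hl e3
  subst e5
  exact Nat.eq_of_mul_eq_mul_right (h.mpos _ _ _ hk) e4

theorem diag_j (h : Good a b n T q R) {k j m l s k' j' m' l' s' : ℕ}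
    (hk : R k j m) (hl : R l j s) (hk' : R k' j' m') (hl' : R l' j' s')
    (hne' : a ≠ b ∨ a * n k' ≠ b * n l')
    (e : a * n k + b * n l' = a * n k' + b * n l) : ¬ j < j' := by
  intro hh
  have := h.powT hh
  have p1 := h.sza _ _ _ hk
  have p3 := h.szb _ _ _ hl
  obtain ⟨e1, e2⟩ := sep_aux (2^(T j')) (b * n l') (a * n k') (a * n k) (b * n l)
    ((h.dvdn hl').mul_left b) ((h.dvdn hk').mul_left a)
      (by omega) (by omega) (by omega)
  have := h.diag_zero hk' hl' e1.symm
  rcases hne' with h1 | h1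
  · exact h1 this
  · exact h1 e1.symm

theorem diag (h : Good a b n T q R) {α β a' b' : ℕ} (hoa : Odd a') (hob : Odd b')
    (ha' : a = 2^α * a') (hb' : b = 2^β * b') {k j m l s k' j' m' l' s' : ℕ}
    (hk : R k j m) (hl : R l j s) (hk' : R k' j' m') (hl' : R l' j' s')
    (hne : a ≠ b ∨ a * n k ≠ b * n l) (hne' : a ≠ b ∨ a * n k' ≠ b * n l')
    (hc : (α + (k + j * m) = β + (l + j * s)) ↔ (α + (k' + j' * m') = β + (l' + j' * s')))
    (e : a * n k + b * n l' = a * n k' + b * n l) : j = j' ∧ m = m' := by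
  have hj : j = j' := by
    have h1 := h.diag_j hk hl hk' hl' hne' e
    have h2 := h.diag_j hk' hl' hk hl hne e.symm
    omega
  subst hj
  refine ⟨rfl, ?_⟩
  have e0 := e
  rw [h.form _ _ _ hk, h.form _ _ _ hl, h.form _ _ _ hk', h.form _ _ _ hl', mul_left_comm,
    mul_left_comm b, mul_left_comm a, mul_left_comm b, ← mul_add, ← mul_add] at e
  have e2 := Nat.eq_of_mul_eq_mul_left (by positivity) e
  obtain ⟨e3, e4⟩ := sep_aux (2^(q j)) (a * 2^(k+j*m) + b * 2^(l'+j*s'))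
    (a * 2^(k'+j*m') + b * 2^(l+j*s)) (a * m + b * s') (a * m' + b * s)
    (Dvd.dvd.add ((h.dvdq hk).mul_left a) ((h.dvdq hl').mul_left b))
    (Dvd.dvd.add ((h.dvdq hk').mul_left a) ((h.dvdq hl).mul_left b))
    (h.small _ _ _ _ _ hk hl') (h.small _ _ _ _ _ hk' hl) (by linarith)
  by_cases hKK : k + j * m = k' + j * m'
  · exact h.eqK hk hk' hKK
  have hE : (α + (k + j * m) = β + (l + j * s)) ∧ (α + (k' + j * m') = β + (l' + j * s')) := by
    rw [ha', hb'] at e3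
    rcases lt_or_gt_of_ne hKK with hlt | hlt
    · have := x1_aux α β a' b' _ _ _ _ hoa hob hlt e3
      exact ⟨this, hc.1 this⟩
    · have := x1_aux α β a' b' _ _ _ _ hoa hob hlt e3.symm
      exact ⟨hc.2 this, this⟩
  obtain ⟨E1, E2⟩ := hE
  have conv1 : ∀ K, a * 2^K = 2^(α+K) * a' := fun K => by rw [ha', pow_add]; ring
  have conv2 : ∀ K, b * 2^K = 2^(β+K) * b' := fun K => by rw [hb', pow_add]; ring
  have hab : a' = b' := by
    rw [conv1, conv1, conv2, conv2, ← E1, ← E2] at e3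
    rcases lt_or_gt_of_ne hKK with hlt | hlt
    · exact x2_aux a' b' _ _ (by omega) e3
    · exact x2_aux a' b' _ _ (by omega) e3.symm
  have z1 : a * 2^(k+j*m) = b * 2^(l+j*s) := by rw [conv1, conv2, E1, hab]
  have z2 : a * 2^(k'+j*m') = b * 2^(l'+j*s') := by rw [conv1, conv2, E2, hab]
  have m1 := h.diag_m hk hl z1
  have m2 := h.diag_m hk' hl' z2
  subst m1 m2
  by_cases hab2 : a = b
  · exfalso
    rcases hne with h1 | h1
    · exact h1 hab2
    · apply h1
      rw [h.form _ _ _ hk, h.form _ _ _ hl, mul_left_comm, mul_left_comm b, mul_add a, mul_add b, z1,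
        hab2]
  · have e5 : ((a:ℤ) - b) * (m - m') = 0 := by
      have : ((a * m + b * m' : ℕ) : ℤ) = ((a * m' + b * m : ℕ) : ℤ) := by rw [e4]
      push_cast at this
      linarith
    rcases mul_eq_zero.1 e5 with h1 | h1
    · exfalso; apply hab2; omega
    · omega

end Good

theorem size1 (j k m a : ℕ) (hj : 5 ≤ j) (hk : k ≤ 2^(3^(j+1))) (hm : m ≤ 2^(3^(j+1)))
    (ha : a ≤ 2^j) :
    2 * (a * (2^(2^(2^(2^j))) * (2^(k + j*m) + m))) < 2^(2^(2^(2^(j+1)))) := by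
  have h1 : 2^(k+j*m) + m ≤ 2^(k+j*m+m) := by
    have h2 : m + 1 ≤ 2^m := Nat.lt_two_pow_self
    have h3 : 1 ≤ 2^(k+j*m) := Nat.one_le_two_pow
    rw [pow_add 2 (k+j*m)]
    nlinarith
  have h2 : 2 * (a * (2^(2^(2^(2^j))) * (2^(k + j*m) + m))) ≤
      2^(1 + j + 2^(2^(2^j)) + (k + j*m+m)) := by
    calc _ ≤ 2 * (2^j * (2^(2^(2^(2^j))) * 2^(k+j*m+m))) := by gcongr
      _ = _ := by rw [pow_add 2 (1 + j + _), pow_add 2 (1+j), pow_add]; ring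
  refine h2.trans_lt (Nat.pow_lt_pow_right (by norm_num) ?_)
  have h3 : ∀ j, 5 ≤ j → 2 * j + 2 ≤ 2^j := by
    intro j hj
    induction j, hj using Nat.le_induction with
    | base => norm_num
    | succ j hj ih => rw [pow_succ]; omega
  set u := 2^(2^j) with hu
  have hu2 : 2^(2^(j+1)) = u * u := by rw [hu, ← pow_add, pow_succ]; ring_nf
  rw [hu2]
  have h4 : 3^(j+1) ≤ u := by
    calc 3^(j+1) ≤ 4^(j+1) := Nat.pow_le_pow_left (by norm_num) _
      _ = 2^(2*(j+1)) := by rw [pow_mul]; norm_num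
      _ ≤ _ := Nat.pow_le_pow_right (by norm_num) (by have := h3 j hj; omega)
  have h5 : 2^(3^(j+1)) ≤ 2^u := Nat.pow_le_pow_right (by norm_num) h4
  have h6 : 2^j < u := Nat.lt_two_pow_self
  have h7 : 2 * j + 2 ≤ 2^j := h3 j hj
  have h8 : u + 1 ≤ 2^u := Nat.lt_two_pow_self
  have hk' := hk.trans h5
  have hm' := hm.trans h5
  have h9 : j * m ≤ j * 2^u := Nat.mul_le_mul_left _ hm'
  calc 1 + j + 2^u + (k + j*m+m) < (j + 4) * 2^u := by nlinarith
    _ ≤ 2^u * 2^u := Nat.mul_le_mul_right _ (by omega)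
    _ = 2^(u+u) := by rw [pow_add]
    _ ≤ _ := Nat.pow_le_pow_right (by norm_num) (by nlinarith)

theorem size2 (j m m' a b : ℕ) (hj : 5 ≤ j) (hm : m ≤ 2^(3^(j+1))) (hm' : m' ≤ 2^(3^(j+1)))
    (ha : a ≤ 2^j) (hb : b ≤ 2^j) : a * m + b * m' < 2^(2^(3^j-1)) := by
  have h1 : a * m + b * m' ≤ 2^(j + 3^(j+1) + 1) := by
    calc a * m + b * m' ≤ 2^j * 2^(3^(j+1)) + 2^j * 2^(3^(j+1)) := by gcongr
      _ = _ := by rw [pow_succ 2 (j + _), pow_add]; ring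
  refine h1.trans_lt (Nat.pow_lt_pow_right (by norm_num) ?_)
  have h2 : j < 3^j := Nat.lt_pow_self (by norm_num)
  have h3 : 3^5 ≤ 3^j := Nat.pow_le_pow_right (by norm_num) hj
  have h4 : ∀ r, 10 ≤ r → 4 * r + 5 < 2^r := by
    intro r hr
    induction r, hr using Nat.le_induction with
    | base => norm_num
    | succ j hj ih => rw [pow_succ]; omega
  have h5 := h4 (3^j - 1) (by omega)
  rw [pow_succ 3 j]
  omega

theorem blk_exists (k : ℕ) (hk : 1 ≤ k) : ∀ J, k < 2^(3^J - 1) → ∃ j < J, k ∈ Blk j := by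
  intro J
  induction J with
  | zero => intro h; norm_num at h; omega
  | succ J ih =>
    intro h
    by_cases h2 : k < 2^(3^J-1)
    · obtain ⟨j, hj, hj2⟩ := ih h2
      exact ⟨j, by omega, hj2⟩
    · exact ⟨J, by omega, by simp only [Blk, Finset.mem_Ico]; omega⟩

theorem st_mono {i j : ℕ} (h : i ≤ j) : 2^(3^i-1) ≤ 2^(3^j-1) :=
  Nat.pow_le_pow_right (by norm_num)
    (Nat.sub_le_sub_right (Nat.pow_le_pow_right (by norm_num) h) 1)

theorem blk_card_pos (j : ℕ) : 1 ≤ (Blk j).card := by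
  have h1 : 0 < 3^j := by positivity
  have : 2^(3^j-1) < 2^(3^(j+1)-1) :=
    Nat.pow_lt_pow_right (by norm_num) (by rw [pow_succ]; omega)
  simp only [Blk, Nat.card_Ico]
  omega

theorem blk_card_le {j i : ℕ} (h : j ≤ i) : (Blk j).card ≤ Nmax i := by
  have h1 : 0 < 2^(3^j-1) := by positivity
  have := st_mono (show j + 1 ≤ i + 1 by omega)
  simp only [Blk, Nat.card_Ico, Nmax]
  omega

theorem sub_card (g : ℕ → ℝ)
    (hg_bounds : ∀ N : ℕ, 1 ≤ N → 1 ≤ g N ∧ g N ≤ N)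
    (blk : ℕ → ℕ → Finset ℕ)
    (hcover : ∀ i k, k ∈ Blk i ↔ ∃ m, m ∈ Finset.Icc 1 (Mblk g i) ∧ k ∈ blk i m)
    (hdisj : ∀ i m m', m ≠ m' → Disjoint (blk i m) (blk i m'))
    (hcard : ∀ i, ∀ m ∈ Finset.Icc 1 (Mblk g i), ∀ m' ∈ Finset.Icc 1 (Mblk g i),
      (blk i m).card ≤ (blk i m').card + 1) (j m : ℕ) (hm : m ∈ Finset.Icc 1 (Mblk g j)) :
    ((blk j m).card : ℝ) ≤ (Blk j).card / g (Blk j).card + 1 := by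
  have h1 : Blk j = (Finset.Icc 1 (Mblk g j)).biUnion (blk j) := by
    ext k
    rw [hcover, Finset.mem_biUnion]
  have h2 : (Blk j).card = ∑ m' ∈ Finset.Icc 1 (Mblk g j), (blk j m').card := by
    rw [h1, Finset.card_biUnion]
    intro x _ y _ hxy
    exact hdisj j x y hxy
  have h3 : Mblk g j * (blk j m).card ≤ (Blk j).card + Mblk g j := by
    calc Mblk g j * (blk j m).card = ∑ m' ∈ Finset.Icc 1 (Mblk g j), (blk j m).card := by simp
      _ ≤ ∑ m' ∈ Finset.Icc 1 (Mblk g j), ((blk j m').card + 1) :=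
        Finset.sum_le_sum (fun m' hm' => hcard j m hm m' hm')
      _ = _ := by rw [Finset.sum_add_distrib, ← h2]; simp
  have hg1 := (hg_bounds _ (blk_card_pos j)).1
  have hMg : g (Blk j).card ≤ Mblk g j := Nat.le_ceil _
  have h3' : (Mblk g j : ℝ) * (blk j m).card ≤ (Blk j).card + Mblk g j := by exact_mod_cast h3
  have hM0 : (0:ℝ) < Mblk g j := by linarith
  have h4 : ((blk j m).card : ℝ) ≤ (Blk j).card / Mblk g j + 1 := by
    rw [div_add_one hM0.ne', le_div_iff₀ hM0]
    linarith
  have h5 : ((Blk j).card : ℝ) / Mblk g j ≤ (Blk j).card / g (Blk j).card := by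
    gcongr
  linarith

theorem ratio_mono (g : ℕ → ℝ)
    (hg_ratio_mono : ∀ N : ℕ, 1 ≤ N → (N : ℝ) / g N ≤ ((N:ℝ)+1) / g (N+1)) {x y : ℕ}
    (hx : 1 ≤ x) (hxy : x ≤ y) : (x:ℝ) / g x ≤ y / g y := by
  induction y, hxy using Nat.le_induction with
  | base => exact le_rfl
  | succ y hy ih =>
    have := hg_ratio_mono y (by omega)
    push_cast
    linarith

set_option maxHeartbeats 1000000 in
theorem statement9
    (g : ℕ → ℝ)
    (hg_bounds : ∀ N : ℕ, 1 ≤ N → 1 ≤ g N ∧ g N ≤ N)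
    (hg_mono : ∀ N : ℕ, 1 ≤ N → g N ≤ g (N+1))
    (hg_ratio_mono : ∀ N : ℕ, 1 ≤ N → (N : ℝ) / g N ≤ ((N:ℝ)+1) / g (N+1))
    (hg_top : Tendsto g atTop atTop)
    (hg_ratio_top : Tendsto (fun N : ℕ => (N : ℝ) / g N) atTop atTop)
    (blk : ℕ → ℕ → Finset ℕ)
    (hcover : ∀ i k, k ∈ Blk i ↔ ∃ m, m ∈ Finset.Icc 1 (Mblk g i) ∧ k ∈ blk i m)
    (hdisj : ∀ i m m', m ≠ m' → Disjoint (blk i m) (blk i m'))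
    (hconsec : ∀ i m m', m < m' → ∀ k ∈ blk i m, ∀ k' ∈ blk i m', k < k')
    (hcard : ∀ i, ∀ m ∈ Finset.Icc 1 (Mblk g i), ∀ m' ∈ Finset.Icc 1 (Mblk g i),
      (blk i m).card ≤ (blk i m').card + 1)
    (n : ℕ → ℕ)
    (hn : ∀ i, ∀ m ∈ Finset.Icc 1 (Mblk g i), ∀ k ∈ blk i m,
      n k = 2^(2^(2^(2^i))) * (2^(k + i*m) + m)) :
    ∀ a b : ℕ, 1 ≤ a → 1 ≤ b → ∃ C : ℝ,
      ∀ i : ℕ, 1 ≤ i → ∀ c : ℤ, (a ≠ b ∨ c ≠ 0) →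
        (solCount n (Nmax i) a b c : ℝ) ≤ C * (Nmax i) / g (Nmax i) := by
  classical
  intro a b ha hb
  set j0 := a + b + 5 with hj0
  set R : ℕ → ℕ → ℕ → Prop := fun k j m => j0 ≤ j ∧ m ∈ Finset.Icc 1 (Mblk g j) ∧ k ∈ blk j m
    with hR
  have hRB : ∀ k j m, R k j m → 2^(3^j-1) ≤ k ∧ k < 2^(3^(j+1)-1) := by
    rintro k j m ⟨-, h2, h3⟩
    have := (hcover j k).2 ⟨m, h2, h3⟩
    simpa [Blk] using this
  have hRk : ∀ k j m, R k j m → k ≤ 2^(3^(j+1)) := by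
    intro k j m h
    have h1 := (hRB k j m h).2
    exact h1.le.trans (Nat.pow_le_pow_right (by norm_num) (Nat.sub_le _ _))
  have hRm : ∀ k j m, R k j m → m ≤ 2^(3^(j+1)) := by
    rintro k j m ⟨-, h2, -⟩
    have h3 := (Finset.mem_Icc.1 h2).2
    have h4 : Mblk g j ≤ (Blk j).card := Nat.ceil_le.2 (hg_bounds _ (blk_card_pos j)).2
    have h5 : (Blk j).card ≤ 2^(3^(j+1)-1) := by simp [Blk]
    have h6 : 2^(3^(j+1)-1) ≤ 2^(3^(j+1)) := Nat.pow_le_pow_right (by norm_num) (Nat.sub_le _ _)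
    omega
  have hla : ∀ j, j0 ≤ j → a ≤ 2^j ∧ b ≤ 2^j := by
    intro j hj
    have : j < 2^j := Nat.lt_two_pow_self
    omega
  have G : Good a b n (fun j => 2^(2^(2^j))) (fun j => 2^(3^j-1)) R := by
    refine ⟨ha, hb, ?_, ?_, ?_, ?_, ?_, ?_, ?_, ?_, ?_, ?_⟩
    · rintro k j m ⟨-, h2, h3⟩
      exact hn j m h2 k h3
    · rintro k j m ⟨-, h2, h3⟩
      exact (Finset.mem_Icc.1 h2).1
    · intro k j m h
      exact (hRB k j m h).1
    · intro k j m k' m' h h'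
      exact size2 j m m' a b (by have := h.1; omega) (hRm _ _ _ h) (hRm _ _ _ h')
        (hla j h.1).1 (hla j h.1).2
    · intro k j m h
      rw [hn j m h.2.1 k h.2.2]
      exact size1 j k m a (by have := h.1; omega) (hRk _ _ _ h) (hRm _ _ _ h) (hla j h.1).1
    · intro k j m h
      rw [hn j m h.2.1 k h.2.2]
      exact size1 j k m b (by have := h.1; omega) (hRk _ _ _ h) (hRm _ _ _ h) (hla j h.1).2
    · intro x y hxy
      have h1 : 2^x ≤ 2^y := Nat.pow_le_pow_right (by norm_num) hxy
      have h2 : 2^(2^x) ≤ 2^(2^y) := Nat.pow_le_pow_right (by norm_num) h1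
      exact Nat.pow_le_pow_right (by norm_num) h2
    · intro k j m k' m' h h' hlt
      exact hconsec j m m' hlt k h.2.2 k' h'.2.2
    · intro k j m h
      exact (hla j h.1).1
    · intro k j m h
      exact (hla j h.1).2
  set H := 2^(3^j0-1) with hH
  have hex : ∀ i k, 1 ≤ k → k ≤ Nmax i → H ≤ k → ∃ j m, R k j m ∧ j ≤ i := by
    intro i k h1 h2 h3
    have h4 : k < 2^(3^(i+1)-1) := by
      have : 0 < 2^(3^(i+1)-1) := by positivity
      simp only [Nmax] at h2
      omega
    obtain ⟨j, hj, hkj⟩ := blk_exists k h1 (i+1) h4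
    obtain ⟨m, hm, hkm⟩ := (hcover j k).1 hkj
    refine ⟨j, m, ⟨?_, hm, hkm⟩, by omega⟩
    by_contra hc
    have h5 := st_mono (show j + 1 ≤ j0 by omega)
    simp only [Blk, Finset.mem_Ico] at hkj
    omega
  have hRi : ∀ i k j m, R k j m → k ≤ Nmax i → j ≤ i := by
    intro i k j m h hk
    by_contra hc
    have h1 := (hRB k j m h).1
    have h5 := st_mono (show i + 1 ≤ j by omega)
    have : 0 < 2^(3^(i+1)-1) := by positivity
    simp only [Nmax] at hk
    omega
  obtain ⟨α, a', hoa, ha'⟩ := Nat.exists_eq_two_pow_mul_odd (n := a) (by omega)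
  obtain ⟨β, b', hob, hb'⟩ := Nat.exists_eq_two_pow_mul_odd (n := b) (by omega)
  refine ⟨H * H + 2 * H + 6, ?_⟩
  intro i hi c hc
  set N := Nmax i with hN
  have hN1 : 1 ≤ N := (blk_card_pos i).trans (blk_card_le le_rfl)
  set S := (Finset.Icc 1 N ×ˢ Finset.Icc 1 N).filter
    (fun p => (a : ℤ) * n p.1 - (b : ℤ) * n p.2 = c) with hS
  have hSm : ∀ p ∈ S, (1 ≤ p.1 ∧ p.1 ≤ N) ∧ (1 ≤ p.2 ∧ p.2 ≤ N) ∧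
      (a : ℤ) * n p.1 - (b : ℤ) * n p.2 = c := by
    intro p hp
    simp only [hS, Finset.mem_filter, Finset.mem_product, Finset.mem_Icc] at hp
    tauto
  have hSe : ∀ p ∈ S, ∀ p' ∈ S, a * n p.1 + b * n p'.2 = a * n p'.1 + b * n p.2 := by
    intro p hp p' hp'
    have h1 := (hSm p hp).2.2
    have h2 := (hSm p' hp').2.2
    zify
    linarith
  have hSne : ∀ p ∈ S, a ≠ b ∨ a * n p.1 ≠ b * n p.2 := by
    intro p hp
    rcases hc with h | h
    · exact Or.inl h
    · right
      intro h2
      apply h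
      rw [← (hSm p hp).2.2]
      zify at h2
      linarith
  have inj2 : ∀ p ∈ S, ∀ p' ∈ S, p.1 = p'.1 → H ≤ p.2 → H ≤ p'.2 → p = p' := by
    intro p hp p' hp' he h1 h2
    have e := hSe p hp p' hp'
    rw [he] at e
    obtain ⟨j, m, h3, -⟩ := hex i p.2 (hSm p hp).2.1.1 (hSm p hp).2.1.2 h1
    obtain ⟨j', m', h3', -⟩ := hex i p'.2 (hSm p' hp').2.1.1 (hSm p' hp').2.1.2 h2
    have e2 : n p.2 = n p'.2 := Nat.eq_of_mul_eq_mul_left hb (by omega)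
    exact Prod.ext he (G.inj h3 h3' e2)
  have inj1 : ∀ p ∈ S, ∀ p' ∈ S, p.2 = p'.2 → H ≤ p.1 → H ≤ p'.1 → p = p' := by
    intro p hp p' hp' he h1 h2
    have e := hSe p hp p' hp'
    rw [he] at e
    obtain ⟨j, m, h3, -⟩ := hex i p.1 (hSm p hp).1.1 (hSm p hp).1.2 h1
    obtain ⟨j', m', h3', -⟩ := hex i p'.1 (hSm p' hp').1.1 (hSm p' hp').1.2 h2
    have e2 : n p.1 = n p'.1 := Nat.eq_of_mul_eq_mul_left ha (by omega)
    exact Prod.ext (G.inj h3 h3' e2) he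
  have hRH : ∀ k j m, R k j m → H ≤ k := by
    intro k j m h
    exact (st_mono h.1).trans (hRB k j m h).1
  -- the classes
  set A0 := S.filter (fun p => p.1 < H ∧ p.2 < H) with hA0
  set A1 := S.filter (fun p => p.1 < H ∧ H ≤ p.2) with hA1
  set A2 := S.filter (fun p => H ≤ p.1 ∧ p.2 < H) with hA2
  set A3 := S.filter (fun p => ∃ j m l s, R p.1 j m ∧ R p.2 l s ∧ l < j) with hA3
  set A4 := S.filter (fun p => ∃ j m l s, R p.1 j m ∧ R p.2 l s ∧ j < l) with hA4
  set A5 := S.filter (fun p => ∃ j m s, R p.1 j m ∧ R p.2 j s ∧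
    α + (p.1 + j * m) = β + (p.2 + j * s)) with hA5
  set A6 := S.filter (fun p => ∃ j m s, R p.1 j m ∧ R p.2 j s ∧
    ¬ (α + (p.1 + j * m) = β + (p.2 + j * s))) with hA6
  have hcov : S ⊆ A0 ∪ A1 ∪ A2 ∪ A3 ∪ A4 ∪ A5 ∪ A6 := by
    intro p hp
    have hm := hSm p hp
    simp only [Finset.mem_union, hA0, hA1, hA2, hA3, hA4, hA5, hA6, Finset.mem_filter, hp,
      true_and]
    by_cases h1 : p.1 < H
    · by_cases h2 : p.2 < H
      · simp [h1, h2]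
      · simp [h1, not_lt.1 h2]
    · by_cases h2 : p.2 < H
      · simp [h2, not_lt.1 h1]
      · obtain ⟨j, m, h3, -⟩ := hex i p.1 hm.1.1 hm.1.2 (not_lt.1 h1)
        obtain ⟨l, s, h4, -⟩ := hex i p.2 hm.2.1.1 hm.2.1.2 (not_lt.1 h2)
        rcases lt_trichotomy j l with h | h | h
        · exact Or.inl (Or.inl (Or.inr ⟨j, m, l, s, h3, h4, h⟩))
        · subst h
          by_cases h5 : α + (p.1 + j * m) = β + (p.2 + j * s)
          · exact Or.inl (Or.inr ⟨j, m, s, h3, h4, h5⟩)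
          · exact Or.inr ⟨j, m, s, h3, h4, h5⟩
        · exact Or.inl (Or.inl (Or.inl (Or.inr ⟨j, m, l, s, h3, h4, h⟩)))
  have c0 : A0.card ≤ H * H := by
    have : A0 ⊆ Finset.range H ×ˢ Finset.range H := by
      intro p hp
      have := (Finset.mem_filter.1 hp).2
      simp only [Finset.mem_product, Finset.mem_range]
      exact this
    simpa using Finset.card_le_card this
  have c1 : A1.card ≤ H := by
    have := Finset.card_le_card_of_injOn (s := A1) (t := Finset.range H) Prod.fst
      (fun p hp => by
        have := (Finset.mem_filter.1 (Finset.mem_coe.1 hp)).2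
        simpa using this.1)
      (fun p hp p' hp' e => by
        have h1 := Finset.mem_filter.1 (Finset.mem_coe.1 hp)
        have h2 := Finset.mem_filter.1 (Finset.mem_coe.1 hp')
        exact inj2 p h1.1 p' h2.1 e h1.2.2 h2.2.2)
    simpa using this
  have c2 : A2.card ≤ H := by
    have := Finset.card_le_card_of_injOn (s := A2) (t := Finset.range H) Prod.snd
      (fun p hp => by
        have := (Finset.mem_filter.1 (Finset.mem_coe.1 hp)).2
        simpa using this.2)
      (fun p hp p' hp' e => by
        have h1 := Finset.mem_filter.1 (Finset.mem_coe.1 hp)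
        have h2 := Finset.mem_filter.1 (Finset.mem_coe.1 hp')
        exact inj1 p h1.1 p' h2.1 e h1.2.1 h2.2.1)
    simpa using this
  have c3 : A3.card ≤ 1 := by
    rw [Finset.card_le_one]
    intro p hp p' hp'
    obtain ⟨hp, j, m, l, s, h1, h2, h3⟩ := Finset.mem_filter.1 hp
    obtain ⟨hp', j', m', l', s', h1', h2', h3'⟩ := Finset.mem_filter.1 hp'
    have := G.off h1 h2 h3 h1' h2' h3' (hSe p hp p' hp')
    exact Prod.ext this.1 this.2
  have c4 : A4.card ≤ 1 := by
    rw [Finset.card_le_one]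
    intro p hp p' hp'
    obtain ⟨hp, j, m, l, s, h1, h2, h3⟩ := Finset.mem_filter.1 hp
    obtain ⟨hp', j', m', l', s', h1', h2', h3'⟩ := Finset.mem_filter.1 hp'
    have := G.symm.off h2 h1 h3 h2' h1' h3' (by have := hSe p hp p' hp'; omega)
    exact Prod.ext this.2 this.1
  have hr1 : (1:ℝ) ≤ N / g N := by
    have := hg_bounds N hN1
    rw [le_div_iff₀ (by linarith)]
    linarith
  have key : ∀ j m, j ≤ i → m ∈ Finset.Icc 1 (Mblk g j) →
      ((blk j m).card : ℝ) ≤ 2 * (N / g N) := by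
    intro j m hj hm
    have h1 := sub_card g hg_bounds blk hcover hdisj hcard j m hm
    have h2 := ratio_mono g hg_ratio_mono (blk_card_pos j) (blk_card_le hj)
    linarith
  have c5 : (A5.card : ℝ) ≤ 2 * (N / g N) := by
    rcases A5.eq_empty_or_nonempty with h | ⟨p, hp⟩
    · rw [h]; simp only [Finset.card_empty, Nat.cast_zero]; linarith
    obtain ⟨hp, j, m, s, h1, h2, h3⟩ := Finset.mem_filter.1 hp
    have hle : A5.card ≤ (blk j m).card := by
      apply Finset.card_le_card_of_injOn Prod.fst
      · intro p' hp'
        obtain ⟨hp', j', m', s', h1', h2', h3'⟩ := Finset.mem_filter.1 (Finset.mem_coe.1 hp')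
        obtain ⟨e1, e2⟩ := G.diag hoa hob ha' hb' h1 h2 h1' h2' (hSne p hp) (hSne p' hp')
          ⟨fun _ => h3', fun _ => h3⟩ (hSe p hp p' hp')
        rw [e1, e2]
        exact h1'.2.2
      · intro p hp p' hp' e
        obtain ⟨hp, j, m, s, h1, h2, h3⟩ := Finset.mem_filter.1 (Finset.mem_coe.1 hp)
        obtain ⟨hp', j', m', s', h1', h2', h3'⟩ := Finset.mem_filter.1 (Finset.mem_coe.1 hp')
        exact inj2 p hp p' hp' e (hRH _ _ _ h2) (hRH _ _ _ h2')
    have := key j m (hRi i _ _ _ h1 (hSm p hp).1.2) h1.2.1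
    have hle' : (A5.card : ℝ) ≤ (blk j m).card := by exact_mod_cast hle
    linarith
  have c6 : (A6.card : ℝ) ≤ 2 * (N / g N) := by
    rcases A6.eq_empty_or_nonempty with h | ⟨p, hp⟩
    · rw [h]; simp only [Finset.card_empty, Nat.cast_zero]; linarith
    obtain ⟨hp, j, m, s, h1, h2, h3⟩ := Finset.mem_filter.1 hp
    have hle : A6.card ≤ (blk j m).card := by
      apply Finset.card_le_card_of_injOn Prod.fst
      · intro p' hp'
        obtain ⟨hp', j', m', s', h1', h2', h3'⟩ := Finset.mem_filter.1 (Finset.mem_coe.1 hp')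
        obtain ⟨e1, e2⟩ := G.diag hoa hob ha' hb' h1 h2 h1' h2' (hSne p hp) (hSne p' hp')
          ⟨fun h => absurd h h3, fun h => absurd h h3'⟩ (hSe p hp p' hp')
        rw [e1, e2]
        exact h1'.2.2
      · intro p hp p' hp' e
        obtain ⟨hp, j, m, s, h1, h2, h3⟩ := Finset.mem_filter.1 (Finset.mem_coe.1 hp)
        obtain ⟨hp', j', m', s', h1', h2', h3'⟩ := Finset.mem_filter.1 (Finset.mem_coe.1 hp')
        exact inj2 p hp p' hp' e (hRH _ _ _ h2) (hRH _ _ _ h2')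
    have := key j m (hRi i _ _ _ h1 (hSm p hp).1.2) h1.2.1
    have hle' : (A6.card : ℝ) ≤ (blk j m).card := by exact_mod_cast hle
    linarith
  have hsum : S.card ≤ H * H + 2 * H + 2 + A5.card + A6.card := by
    have h0 := Finset.card_le_card hcov
    have h1 := Finset.card_union_le (A0 ∪ A1 ∪ A2 ∪ A3 ∪ A4 ∪ A5) A6
    have h2 := Finset.card_union_le (A0 ∪ A1 ∪ A2 ∪ A3 ∪ A4) A5
    have h3 := Finset.card_union_le (A0 ∪ A1 ∪ A2 ∪ A3) A4
    have h4 := Finset.card_union_le (A0 ∪ A1 ∪ A2) A3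
    have h5 := Finset.card_union_le (A0 ∪ A1) A2
    have h6 := Finset.card_union_le A0 A1
    omega
  have hsum' : (S.card : ℝ) ≤ (H:ℝ) * H + 2 * H + 2 + A5.card + A6.card := by exact_mod_cast hsum
  have hfin : (S.card : ℝ) ≤ ((H:ℝ) * H + 2 * H + 6) * (N / g N) := by
    have hH0 : (0:ℝ) ≤ (H:ℝ) * H + 2 * H + 2 := by positivity
    have := mul_le_mul_of_nonneg_left hr1 hH0
    linarith
  rw [mul_div_assoc]
  exact hfin
end

section
/- For the constructed sequence (n_k)_{k≥1}, let a, b be positive integers with a = 2^r·b for some integer r ≥ 1. Then for all sufficiently large i, all 1 ≤ m ≤ M(i), and all k, ℓ ∈ Δ_i^{(m)}: if k + r > ℓ then a·n_k − b·n_ℓ ≥ min_{j ∈ Δ_i^{(m)}} n_j, and if k + r < ℓ then a·n_k − b·n_ℓ ≤ −min_{j ∈ Δ_i^{(m)}} n_j. Moreover, any solution of a·n_k − b·n_ℓ = c with k, ℓ ∈ Δ_i^{(m)} satisfies |c| ≤ max(a,b)·max_{j ∈ Δ_i^{(m)}} n_j. -/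
open Filter

theorem statement12
    (g : ℕ → ℝ)
    (hg_bounds : ∀ N : ℕ, 1 ≤ N → 1 ≤ g N ∧ g N ≤ N)
    (hg_mono : ∀ N : ℕ, 1 ≤ N → g N ≤ g (N+1))
    (hg_ratio_mono : ∀ N : ℕ, 1 ≤ N → (N : ℝ) / g N ≤ ((N:ℝ)+1) / g (N+1))
    (hg_top : Tendsto g atTop atTop)
    (hg_ratio_top : Tendsto (fun N : ℕ => (N : ℝ) / g N) atTop atTop)
    (blk : ℕ → ℕ → Finset ℕ)
    (hcover : ∀ i k, k ∈ Blk i ↔ ∃ m, m ∈ Finset.Icc 1 (Mblk g i) ∧ k ∈ blk i m)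
    (hdisj : ∀ i m m', m ≠ m' → Disjoint (blk i m) (blk i m'))
    (hconsec : ∀ i m m', m < m' → ∀ k ∈ blk i m, ∀ k' ∈ blk i m', k < k')
    (hcard : ∀ i, ∀ m ∈ Finset.Icc 1 (Mblk g i), ∀ m' ∈ Finset.Icc 1 (Mblk g i),
      (blk i m).card ≤ (blk i m').card + 1)
    (n : ℕ → ℕ)
    (hn : ∀ i, ∀ m ∈ Finset.Icc 1 (Mblk g i), ∀ k ∈ blk i m,
      n k = 2^(2^(2^(2^i))) * (2^(k + i*m) + m))
    (a b r : ℕ) (hb : 1 ≤ b) (hr : 1 ≤ r) (hab : a = 2^r * b) :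
    ∃ i₀ : ℕ, ∀ i, i₀ ≤ i → ∀ m ∈ Finset.Icc 1 (Mblk g i),
      ∀ k l : ℕ, ∀ hk : k ∈ blk i m, ∀ hl : l ∈ blk i m,
        -- if k + r > ℓ then a·n_k − b·n_ℓ ≥ min over the sub-block
        (l < k + r →
          (((blk i m).inf' ⟨k, hk⟩ n : ℕ) : ℤ) ≤ (a : ℤ) * n k - (b : ℤ) * n l) ∧
        -- if k + r < ℓ then a·n_k − b·n_ℓ ≤ − min over the sub-block
        (k + r < l →
          (a : ℤ) * n k - (b : ℤ) * n l ≤ -(((blk i m).inf' ⟨k, hk⟩ n : ℕ) : ℤ)) ∧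
        -- any solution a·n_k − b·n_ℓ = c satisfies |c| ≤ max(a,b)·max over the sub-block
        (∀ c : ℤ, (a : ℤ) * n k - (b : ℤ) * n l = c →
          |c| ≤ (max a b : ℤ) * (((blk i m).sup' ⟨k, hk⟩ n : ℕ) : ℤ)) := by
  refine ⟨1, fun i hi m hm k l hk hl => ?_⟩
  have hk1 : 1 ≤ k := by
    have h : k ∈ Blk i := (hcover i k).2 ⟨m, hm, hk⟩
    have h2 := (Finset.mem_Ico.1 h).1
    exact le_trans Nat.one_le_two_pow h2
  have hinf : (((blk i m).inf' ⟨k, hk⟩ n : ℕ) : ℤ) ≤ n k := by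
    exact_mod_cast Finset.inf'_le n hk
  have hsk : (n k : ℤ) ≤ (((blk i m).sup' ⟨k, hk⟩ n : ℕ) : ℤ) := by
    exact_mod_cast Finset.le_sup' n hk
  have hsl : (n l : ℤ) ≤ (((blk i m).sup' ⟨k, hk⟩ n : ℕ) : ℤ) := by
    exact_mod_cast Finset.le_sup' n hl
  have hb' : (1 : ℤ) ≤ b := by exact_mod_cast hb
  obtain ⟨s, rfl⟩ : ∃ s, r = s + 1 := ⟨r - 1, by omega⟩
  have hS : (1 : ℤ) ≤ 2 ^ s := one_le_pow₀ (by norm_num)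
  have hkm : (2 * m : ℤ) ≤ 2 ^ (k + i * m) := by
    have h1 : m < 2 ^ m := Nat.lt_two_pow_self
    have h2 : 2 ^ (m + 1) ≤ 2 ^ (k + i * m) := Nat.pow_le_pow_right (by norm_num) (by nlinarith)
    have h3 : 2 * m ≤ 2 ^ (k + i * m) := by rw [pow_succ] at h2; omega
    exact_mod_cast h3
  have hm0 : (0 : ℤ) ≤ m := Int.natCast_nonneg m
  have hnk : (n k : ℤ) = 2^(2^(2^(2^i))) * (2^(k + i*m) + m) := by
    rw [hn i m hm k hk]; push_cast; ring
  have hnl : (n l : ℤ) = 2^(2^(2^(2^i))) * (2^(l + i*m) + m) := by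
    rw [hn i m hm l hl]; push_cast; ring
  have hC : (0 : ℤ) ≤ 2^(2^(2^(2^i))) := by positivity
  have ha : (a : ℤ) = 2 * 2 ^ s * b := by rw [hab]; push_cast; ring
  refine ⟨fun h => hinf.trans ?_, fun h => le_trans ?_ (neg_le_neg hinf), ?_⟩
  · have hL : (2 : ℤ) ^ (l + i * m) ≤ 2 ^ s * 2 ^ (k + i * m) := by
      rw [← pow_add]; exact pow_le_pow_right₀ (by norm_num) (by omega)
    rw [hnk, hnl, ha]
    generalize (2 : ℤ)^(2^(2^(2^i))) = C at *
    generalize (2 : ℤ)^(k + i * m) = K at *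
    generalize (2 : ℤ)^(l + i * m) = L at *
    generalize (2 : ℤ)^s = S at *
    have hK : 0 ≤ K := by linarith
    have e1 : K + m ≤ 2 * S * (K + m) - (L + m) := by nlinarith
    have e2 : K + m ≤ b * (2 * S * (K + m) - (L + m)) := by nlinarith
    have := mul_le_mul_of_nonneg_left e2 hC
    linarith
  · have hL : 2 * (2 * 2 ^ s * 2 ^ (k + i * m)) ≤ (2 : ℤ) ^ (l + i * m) := by
      have : 2 * (2 * 2 ^ s * 2 ^ (k + i * m)) = (2 : ℤ) ^ (s + 2 + (k + i * m)) := by ring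
      rw [this]; exact pow_le_pow_right₀ (by norm_num) (by omega)
    rw [hnk, hnl, ha]
    generalize (2 : ℤ)^(2^(2^(2^i))) = C at *
    generalize (2 : ℤ)^(k + i * m) = K at *
    generalize (2 : ℤ)^(l + i * m) = L at *
    generalize (2 : ℤ)^s = S at *
    have hK : 0 ≤ K := by linarith
    have e0 : S * (2 * m) ≤ S * K := mul_le_mul_of_nonneg_left hkm (by linarith)
    have e3 : 1 * K ≤ S * K := mul_le_mul_of_nonneg_right hS hK
    have e1 : K + m ≤ (L + m) - 2 * S * (K + m) := by nlinarith
    have e2 : K + m ≤ b * ((L + m) - 2 * S * (K + m)) := by nlinarith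
    have := mul_le_mul_of_nonneg_left e2 hC
    linarith
  · rintro c rfl
    have h1 : (a : ℤ) * n k ≤ (max a b : ℤ) * (((blk i m).sup' ⟨k, hk⟩ n : ℕ) : ℤ) :=
      mul_le_mul (le_max_left _ _) hsk (by positivity) (by positivity)
    have h2 : (b : ℤ) * n l ≤ (max a b : ℤ) * (((blk i m).sup' ⟨k, hk⟩ n : ℕ) : ℤ) :=
      mul_le_mul (le_max_right _ _) hsl (by positivity) (by positivity)
    have h3 : (0 : ℤ) ≤ (a : ℤ) * n k := by positivity
    have h4 : (0 : ℤ) ≤ (b : ℤ) * n l := by positivity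
    rw [abs_le]
    constructor <;> linarith
end
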